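/- Let n ≥ 2 and let M = (a, b; c, d) ∈ SAV(ℝ⊕ℝ^{n−1}). Let f : H⁺ → Cl_n be a smooth left monogenic function (Df = 0 on H⁺) satisfying f(x) = (conj(cx+d)/‖cx+d‖^{n+1}) · f(M<x>) for all x ∈ H⁺. Then g(x) := x_n^{(n−1)/2} f(x) satisfies g(x) = (conj(cx+d)/‖cx+d‖²) · g(M<x>) for all x ∈ H⁺, and every real component u of g satisfies the Maaß wave equation Δu − ((n−1)/x_n) ∂u/∂x_n + ((n²−1)/4) u/x_n² = 0 on H⁺; in particular u is an eigenfunction of the Laplace–Beltrami operator x_n²Δ − (n−1)x_n ∂/∂x_n with eigenvalue −(n²−1)/4. -/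

import Mathlib

noncomputable section

open scoped symmDiff

/-- An explicit model of the real Clifford algebra `Cl_n` with generators `e 0, …, e (n-1)`
satisfying `eᵢ eⱼ + eⱼ eᵢ = -2 δᵢⱼ` (the Clifford algebra of the negative definite
quadratic form on `ℝⁿ`): elements are coordinate functions on the canonical basis
`(e_A)_{A ⊆ {0,…,n-1}}`, where `e_A` is the (increasingly ordered) product of the `e i`, `i ∈ A`. -/
def Cl (n : ℕ) : Type := Finset (Fin n) → ℝ

namespace Cl

variable {n : ℕ}

instance : NormedAddCommGroup (Cl n) :=
  inferInstanceAs (NormedAddCommGroup (Finset (Fin n) → ℝ))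

instance : NormedSpace ℝ (Cl n) :=
  inferInstanceAs (NormedSpace ℝ (Finset (Fin n) → ℝ))

/-- The coefficient of `a` at the basis element `e_A`. -/
def coeff (a : Cl n) (A : Finset (Fin n)) : ℝ := a A

/-- The sign occurring in the product `e_A * e_B = mulSign A B • e_{A ∆ B}`,
coming from the relations `eᵢ eⱼ = -eⱼ eᵢ` (i ≠ j) and `eᵢ² = -1`. -/
def mulSign (A B : Finset (Fin n)) : ℝ :=
  (-1 : ℝ) ^ (((A ×ˢ B).filter fun p => p.2 < p.1).card + (A ∩ B).card)

/-- Clifford multiplication. -/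
def mul (a b : Cl n) : Cl n := fun C =>
  ∑ A : Finset (Fin n), ∑ B : Finset (Fin n),
    if A ∆ B = C then mulSign A B * a A * b B else 0

/-- The unit `1` of the Clifford algebra. -/
def one : Cl n := Pi.single ∅ 1

/-- The embedding of the real scalars. -/
def scalar (r : ℝ) : Cl n := Pi.single ∅ r

/-- The generators `e i` (in the paper: `e_1, …, e_n`). -/
def e (i : Fin n) : Cl n := Pi.single {i} 1

/-- Reversion: the anti-automorphism fixing all the `e i`. -/
def reverse (a : Cl n) : Cl n := fun A => (-1 : ℝ) ^ (A.card * (A.card - 1) / 2) * a A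

/-- The main involution `′`: the automorphism with `(e i)′ = - e i`. -/
def involute (a : Cl n) : Cl n := fun A => (-1 : ℝ) ^ A.card * a A

/-- Clifford conjugation: the anti-automorphism with `conj (e i) = - e i`
(the composite of reversion and the main involution). -/
def conj (a : Cl n) : Cl n := fun A => (-1 : ℝ) ^ (A.card * (A.card + 1) / 2) * a A

/-- The norm on `Cl n`: the square root of the sum of the squares of the
coordinates in the standard basis. -/
def norm (a : Cl n) : ℝ := Real.sqrt (∑ A : Finset (Fin n), a A ^ 2)

/-- Invertibility in the Clifford algebra. -/
def IsInvertible (a : Cl n) : Prop := ∃ b, mul a b = one ∧ mul b a = one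

/-- The inverse of an invertible Clifford number (junk value `0` otherwise). -/
def inv (a : Cl n) : Cl n :=
  letI := Classical.propDecidable (IsInvertible a)
  if h : IsInvertible a then h.choose else 0

/-- The paravector `x₀ + x₁ e₁ + ⋯ + xₙ eₙ` attached to `x ∈ ℝ^{n+1}`. -/
def para (x : Fin (n + 1) → ℝ) : Cl n :=
  scalar (x 0) + ∑ i : Fin n, x i.succ • e i

/-- Being a paravector. -/
def IsParavector (a : Cl n) : Prop := ∃ x : Fin (n + 1) → ℝ, a = para x

/-- The coordinates in `ℝ^{n+1}` of (the paravector part of) a Clifford number. -/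
def paraCoord (a : Cl n) : Fin (n + 1) → ℝ :=
  Fin.cases (coeff a ∅) (fun i => coeff a {i})

/-- Being a (possibly empty) product of nonzero paravectors. -/
def IsProdOfParavectors (a : Cl n) : Prop :=
  ∃ l : List (Fin (n + 1) → ℝ), (∀ x ∈ l, x ≠ 0) ∧
    a = l.foldr (fun x b => mul (para x) b) one

/-- The special Ahlfors–Vahlen group `SAV(ℝ ⊕ ℝⁿ)`: 2×2 matrices `(a b; c d)` with entries
in `Cl n` such that each entry is `0` or a product of nonzero paravectors,
`a ⬝ reverse d - b ⬝ reverse c = 1`, and `a c⁻¹, c⁻¹ d` are paravectors if `c ≠ 0`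
resp. `b d⁻¹` is a paravector if `c = 0`. -/
structure SAV (n : ℕ) where
  a : Cl n
  b : Cl n
  c : Cl n
  d : Cl n
  prod_a : a = 0 ∨ IsProdOfParavectors a
  prod_b : b = 0 ∨ IsProdOfParavectors b
  prod_c : c = 0 ∨ IsProdOfParavectors c
  prod_d : d = 0 ∨ IsProdOfParavectors d
  det : mul a (reverse d) - mul b (reverse c) = one
  cond_c : c ≠ 0 → IsParavector (mul a (inv c)) ∧ IsParavector (mul (inv c) d)
  cond_c0 : c = 0 → IsParavector (mul b (inv d))

/-- The Clifford number `c x + d` attached to a matrix `M` and `x ∈ ℝ^{n+1}`. -/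
def cxd (M : SAV n) (x : Fin (n + 1) → ℝ) : Cl n := mul M.c (para x) + M.d

/-- The numerator `a x + b`. -/
def axb (M : SAV n) (x : Fin (n + 1) → ℝ) : Cl n := mul M.a (para x) + M.b

/-- The Möbius transformation `M<x> = (ax+b)(cx+d)⁻¹` as a Clifford number. -/
def moebiusCl (M : SAV n) (x : Fin (n + 1) → ℝ) : Cl n := mul (axb M x) (inv (cxd M x))

/-- The Möbius transformation `M<x>` as a point of `ℝ^{n+1}`. -/
def moebius (M : SAV n) (x : Fin (n + 1) → ℝ) : Fin (n + 1) → ℝ :=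
  paraCoord (moebiusCl M x)

/-- `a` lies in the subalgebra `Cl_{n-1}` generated by the `e j` with `j ≠ i`. -/
def memSub (a : Cl n) (i : Fin n) : Prop := ∀ A : Finset (Fin n), i ∈ A → coeff a A = 0

/-- The subgroup `SAV(ℝ ⊕ ℝ^{m})` of `SAV(ℝ ⊕ ℝ^{m+1})` of matrices whose entries lie
in the subalgebra `Cl_m ⊆ Cl_{m+1}`. -/
structure SAVsub (m : ℕ) extends SAV (m + 1) where
  sub_a : memSub a (Fin.last m)
  sub_b : memSub b (Fin.last m)
  sub_c : memSub c (Fin.last m)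
  sub_d : memSub d (Fin.last m)

/-- The `P`-part of `a ∈ Cl_{m+1} = Cl_m ⊕ Cl_m e_{top}`: `a = P a + (Q a) e_top`. -/
def Ppart {m : ℕ} (a : Cl (m + 1)) : Cl (m + 1) := fun A =>
  if Fin.last m ∈ A then 0 else a A

/-- The `Q`-part of `a ∈ Cl_{m+1} = Cl_m ⊕ Cl_m e_{top}`: `a = P a + (Q a) e_top`. -/
def Qpart {m : ℕ} (a : Cl (m + 1)) : Cl (m + 1) := fun A =>
  if Fin.last m ∈ A then 0 else a (insert (Fin.last m) A)

/-- Partial derivative `∂f/∂xᵢ`. -/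
def pderiv {E : Type*} [NormedAddCommGroup E] [NormedSpace ℝ E] {m : ℕ}
    (i : Fin m) (f : (Fin m → ℝ) → E) (x : Fin m → ℝ) : E :=
  fderiv ℝ f x (Pi.single i 1)

/-- The Euclidean Laplacian `Δ = Σᵢ ∂²/∂xᵢ²` (acting componentwise). -/
def lap {E : Type*} [NormedAddCommGroup E] [NormedSpace ℝ E] {m : ℕ}
    (f : (Fin m → ℝ) → E) : (Fin m → ℝ) → E :=
  fun x => ∑ i : Fin m, pderiv i (pderiv i f) x

/-- The Euclidean Dirac operator `D f = ∂f/∂x₀ + Σᵢ eᵢ ∂f/∂xᵢ`. -/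
def dirac (f : (Fin (n + 1) → ℝ) → Cl n) : (Fin (n + 1) → ℝ) → Cl n :=
  fun x => pderiv 0 f x + ∑ i : Fin n, mul (e i) (pderiv i.succ f x)

/-- Upper half-space `H⁺ = {x ∈ ℝ^{n+1} : xₙ > 0}`. -/
def upperHalf (n : ℕ) : Set (Fin (n + 1) → ℝ) := {x | 0 < x (Fin.last n)}

/-- The Euclidean norm on `ℝ^m`. -/
def enorm {m : ℕ} (x : Fin m → ℝ) : ℝ := Real.sqrt (∑ i, x i ^ 2)

end Cl

namespace Cl

variable {n : ℕ}

/-! ### The sign cocycle -/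

theorem prod_symmDiff_of_mul_self {ι M : Type*} [DecidableEq ι] [CommMonoid M]
    (h : ι → M) (hh : ∀ i, h i * h i = 1) (A B : Finset ι) :
    ∏ i ∈ A ∆ B, h i = (∏ i ∈ A, h i) * ∏ i ∈ B, h i := by
  have hdisj : Disjoint (A \ B) (B \ A) := disjoint_sdiff_sdiff
  have hone : (∏ i ∈ A ∩ B, h i) * ∏ i ∈ A ∩ B, h i = 1 := by
    rw [← Finset.prod_mul_distrib]; simp [hh]
  have hU : A ∆ B = (A \ B) ∪ (B \ A) := rfl
  rw [hU, Finset.prod_union hdisj, ← Finset.prod_inter_mul_prod_sdiff A B,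
    ← Finset.prod_inter_mul_prod_sdiff B A, Finset.inter_comm B A, mul_mul_mul_comm, hone, one_mul]

/-- The sign of a pair of indices, from which `mulSign` is assembled multiplicatively. -/
def pairSign (i j : Fin n) : ℝ := if j ≤ i then -1 else 1

theorem pairSign_mul_self (i j : Fin n) : pairSign i j * pairSign i j = 1 := by
  unfold pairSign; split_ifs <;> norm_num

theorem mulSign_eq_prod (A B : Finset (Fin n)) :
    mulSign A B = ∏ i ∈ A, ∏ j ∈ B, pairSign i j := by
  have hcard : ((A ×ˢ B).filter fun p => p.2 ≤ p.1).card =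
      ((A ×ˢ B).filter fun p => p.2 < p.1).card + (A ∩ B).card := by
    have hdiag : (A ∩ B).card = ((A ×ˢ B).filter fun p => p.2 = p.1).card := by
      refine Finset.card_bij (fun i _ => (i, i)) ?_ ?_ ?_
      · simp
      · simp
      · rintro ⟨i, j⟩ h
        simp only [Finset.mem_filter, Finset.mem_product] at h
        obtain ⟨⟨hi, hj⟩, rfl⟩ := h
        exact ⟨j, by simp [hi, hj], rfl⟩
    rw [hdiag, ← Finset.card_union_of_disjoint, ← Finset.filter_or]
    · simp only [le_iff_lt_or_eq]
    · rw [Finset.disjoint_filter]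
      exact fun p _ h h' => h.ne h'
  rw [mulSign, ← hcard, ← Finset.prod_product', ← Finset.prod_const,
    Finset.prod_filter]
  rfl

theorem mulSign_symmDiff_left (A B C : Finset (Fin n)) :
    mulSign (A ∆ B) C = mulSign A C * mulSign B C := by
  simp only [mulSign_eq_prod]
  refine prod_symmDiff_of_mul_self _ (fun i => ?_) A B
  simp [← Finset.prod_mul_distrib, pairSign_mul_self]

theorem mulSign_symmDiff_right (A B C : Finset (Fin n)) :
    mulSign A (B ∆ C) = mulSign A B * mulSign A C := by
  simp only [mulSign_eq_prod, ← Finset.prod_mul_distrib]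
  exact Finset.prod_congr rfl fun i _ => prod_symmDiff_of_mul_self _ (pairSign_mul_self i) B C

theorem mulSign_mul_self (A B : Finset (Fin n)) : mulSign A B * mulSign A B = 1 := by
  rw [← mulSign_symmDiff_right, symmDiff_self]
  simp [mulSign_eq_prod]

@[simp] theorem mulSign_empty_left (A : Finset (Fin n)) : mulSign ∅ A = 1 := by
  simp [mulSign_eq_prod]

@[simp] theorem mulSign_empty_right (A : Finset (Fin n)) : mulSign A ∅ = 1 := by
  simp [mulSign_eq_prod]

theorem mulSign_self (A : Finset (Fin n)) :
    mulSign A A = (-1) ^ (A.card * (A.card + 1) / 2) := by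
  induction A using Finset.induction_on_max with
  | empty => simp
  | insert a s hs ih =>
    have ha : a ∉ s := fun h => lt_irrefl _ (hs a h)
    have h1 : ∏ j ∈ s, pairSign a j = (-1) ^ s.card := by
      rw [← Finset.prod_const]
      exact Finset.prod_congr rfl fun j hj => if_pos (hs j hj).le
    have h2 : ∏ i ∈ s, pairSign i a = 1 :=
      Finset.prod_eq_one fun i hi => if_neg (hs i hi).not_ge
    have h3 : pairSign a a = -1 := if_pos le_rfl
    rw [mulSign_eq_prod] at ih ⊢
    rw [Finset.prod_insert ha]
    simp only [Finset.prod_insert ha, Finset.prod_mul_distrib]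
    rw [h1, h2, h3, ih, Finset.card_insert_of_notMem ha]
    have h4 : (s.card + 1) * (s.card + 1 + 1) / 2 = s.card * (s.card + 1) / 2 + (s.card + 1) := by
      rw [← Nat.add_mul_div_left _ _ two_pos]; congr 1; ring
    rw [h4, pow_add, pow_succ]; ring

theorem neg_one_pow_card_symmDiff (A B : Finset (Fin n)) :
    (-1 : ℝ) ^ (A ∆ B).card = (-1) ^ A.card * (-1) ^ B.card := by
  simpa only [Finset.prod_const] using
    prod_symmDiff_of_mul_self (fun _ : Fin n => (-1 : ℝ)) (by simp) A B

/-! ### Coefficients -/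

theorem coeff_ext {a b : Cl n} (h : ∀ A, coeff a A = coeff b A) : a = b := funext h

@[simp] theorem coeff_add (a b : Cl n) (A) : coeff (a + b) A = coeff a A + coeff b A := rfl
@[simp] theorem coeff_neg (a : Cl n) (A) : coeff (-a) A = -coeff a A := rfl
@[simp] theorem coeff_zero (A) : coeff (0 : Cl n) A = 0 := rfl
@[simp] theorem coeff_smul (r : ℝ) (a : Cl n) (A) : coeff (r • a) A = r * coeff a A := rfl

theorem coeff_conj (a : Cl n) (A) : coeff (conj a) A = mulSign A A * coeff a A := by
  rw [mulSign_self]; rfl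

theorem coeff_involute (a : Cl n) (A) : coeff (involute a) A = (-1) ^ A.card * coeff a A := rfl

theorem coeff_reverse (a : Cl n) (A) :
    coeff (reverse a) A = (-1) ^ A.card * (mulSign A A * coeff a A) := by
  have h : A.card * (A.card + 1) / 2 = A.card * (A.card - 1) / 2 + A.card := by
    rw [← Nat.add_mul_div_left _ _ two_pos]
    congr 1
    rcases A.card with _ | k
    · rfl
    · rw [Nat.add_sub_cancel]; ring
  have hs : (-1 : ℝ) ^ A.card * (-1) ^ A.card = 1 := by
    rw [← mul_pow]; simp
  change (-1 : ℝ) ^ (A.card * (A.card - 1) / 2) * coeff a A = _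
  rw [mulSign_self, h, pow_add]
  linear_combination (-((-1 : ℝ) ^ (A.card * (A.card - 1) / 2) * coeff a A)) * hs

theorem coeff_one (A) : coeff (one : Cl n) A = if A = ∅ then 1 else 0 := by
  simp [coeff, one, Pi.single_apply]

theorem coeff_e (i : Fin n) (A) : coeff (e i) A = if A = {i} then 1 else 0 := by
  simp [coeff, e, Pi.single_apply]

theorem scalar_eq_smul_one (r : ℝ) : (scalar r : Cl n) = r • one := by
  refine coeff_ext fun A => ?_
  rw [coeff_smul, coeff_one]
  simp [coeff, scalar, Pi.single_apply]

theorem coeff_mul (a b : Cl n) (C) :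
    coeff (mul a b) C = ∑ A, mulSign A (A ∆ C) * coeff a A * coeff b (A ∆ C) := by
  rw [coeff, mul]
  refine Finset.sum_congr rfl fun A _ => ?_
  have : ∀ B, (A ∆ B = C) = (B = A ∆ C) := fun B => by
    rw [eq_iff_iff]
    exact ⟨fun h => by rw [← h, symmDiff_symmDiff_cancel_left],
      fun h => by rw [h, symmDiff_symmDiff_cancel_left]⟩
  simp [this, coeff]

theorem sum_symmDiff_left {M : Type*} [AddCommMonoid M] (A : Finset (Fin n))
    (h : Finset (Fin n) → M) : ∑ B, h (A ∆ B) = ∑ B, h B :=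
  Fintype.sum_bijective (A ∆ ·) (Function.Involutive.bijective
    fun B => symmDiff_symmDiff_cancel_left A B) _ _ fun _ => rfl

theorem sum_symmDiff_right {M : Type*} [AddCommMonoid M] (A : Finset (Fin n))
    (h : Finset (Fin n) → M) : ∑ B, h (B ∆ A) = ∑ B, h B := by
  simp only [symmDiff_comm _ A, sum_symmDiff_left]

theorem coeff_mul' (a b : Cl n) (C) :
    coeff (mul a b) C = ∑ B, mulSign (B ∆ C) B * coeff a (B ∆ C) * coeff b B := by
  rw [coeff_mul, ← sum_symmDiff_right (M := ℝ) C]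
  simp only [symmDiff_symmDiff_cancel_right]

theorem coeff_e_mul (i : Fin n) (b : Cl n) (C) :
    coeff (mul (e i) b) C = mulSign {i} ({i} ∆ C) * coeff b ({i} ∆ C) := by
  rw [coeff_mul, Finset.sum_eq_single {i}]
  · simp [coeff_e]
  · intro A _ hA
    simp [coeff_e, hA]
  · simp

theorem coeff_mul_e (i : Fin n) (a : Cl n) (C) :
    coeff (mul a (e i)) C = mulSign ({i} ∆ C) {i} * coeff a ({i} ∆ C) := by
  rw [coeff_mul', Finset.sum_eq_single {i}]
  · simp [coeff_e]
  · intro A _ hA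
    simp [coeff_e, hA]
  · simp

/-! ### The ring structure -/

theorem mul_assoc_aux (a b c : Cl n) : mul (mul a b) c = mul a (mul b c) := by
  refine coeff_ext fun D => ?_
  rw [coeff_mul, coeff_mul]
  simp only [coeff_mul, Finset.mul_sum, Finset.sum_mul]
  rw [Finset.sum_comm]
  refine Finset.sum_congr rfl fun A _ => ?_
  rw [← sum_symmDiff_left A]
  refine Finset.sum_congr rfl fun B _ => ?_
  rw [symmDiff_symmDiff_cancel_left]
  have h1 : A ∆ B ∆ D = B ∆ (A ∆ D) := by rw [symmDiff_comm A B, symmDiff_assoc]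
  have h2 : A ∆ D = B ∆ (B ∆ (A ∆ D)) := (symmDiff_symmDiff_cancel_left _ _).symm
  rw [h1, mulSign_symmDiff_left]
  conv_rhs => rw [h2, mulSign_symmDiff_right, symmDiff_symmDiff_cancel_left]
  ring

theorem one_mul_aux (a : Cl n) : mul one a = a := by
  refine coeff_ext fun D => ?_
  rw [coeff_mul, Finset.sum_eq_single ∅]
  · rw [← Finset.bot_eq_empty, bot_symmDiff, Finset.bot_eq_empty]
    simp [coeff_one]
  · intro A _ hA
    simp [coeff_one, hA]
  · simp

theorem mul_one_aux (a : Cl n) : mul a one = a := by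
  refine coeff_ext fun D => ?_
  rw [coeff_mul', Finset.sum_eq_single ∅]
  · rw [← Finset.bot_eq_empty, bot_symmDiff, Finset.bot_eq_empty]
    simp [coeff_one]
  · intro A _ hA
    simp [coeff_one, hA]
  · simp

/-- The ring structure on `Cl n` given by Clifford multiplication. -/
@[reducible] def cliffordRing : Ring (Cl n) where
  __ := (inferInstance : AddCommGroup (Cl n))
  mul := mul
  one := one
  mul_assoc := mul_assoc_aux
  one_mul := one_mul_aux
  mul_one := mul_one_aux
  zero_mul a := coeff_ext fun D => by
    change coeff (mul 0 a) D = 0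
    simp [coeff_mul]
  mul_zero a := coeff_ext fun D => by
    change coeff (mul a 0) D = 0
    simp [coeff_mul]
  left_distrib a b c := coeff_ext fun D => by
    change coeff (mul a (b + c)) D = coeff (mul a b + mul a c) D
    simp only [coeff_mul, coeff_add, mul_add, Finset.sum_add_distrib]
  right_distrib a b c := coeff_ext fun D => by
    change coeff (mul (a + b) c) D = coeff (mul a c + mul b c) D
    simp only [coeff_mul, coeff_add, mul_add, add_mul, Finset.sum_add_distrib]

section

attribute [local instance] cliffordRing

theorem mul_eq (a b : Cl n) : mul a b = a * b := rfl

theorem one_eq : (one : Cl n) = 1 := rfl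

/-- The real algebra structure on `Cl n`. -/
@[reducible] def cliffordAlgebra : Algebra ℝ (Cl n) :=
  Algebra.ofModule
    (fun r a b => coeff_ext fun D => by
      simp only [← mul_eq, coeff_mul, coeff_smul, Finset.mul_sum]
      exact Finset.sum_congr rfl fun A _ => by ring)
    (fun r a b => coeff_ext fun D => by
      simp only [← mul_eq, coeff_mul, coeff_smul, Finset.mul_sum]
      exact Finset.sum_congr rfl fun A _ => by ring)

attribute [local instance] cliffordAlgebra

theorem coeff_sum {ι : Type*} (s : Finset ι) (a : ι → Cl n) (A) :
    coeff (∑ i ∈ s, a i) A = ∑ i ∈ s, coeff (a i) A :=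
  Finset.sum_apply (M := fun _ : Finset (Fin n) => ℝ) A s a

/-! ### The involutions -/

theorem conj_mul (a b : Cl n) : conj (a * b) = conj b * conj a := by
  refine coeff_ext fun D => ?_
  simp only [← mul_eq]
  rw [coeff_conj, coeff_mul, coeff_mul', Finset.mul_sum]
  refine Finset.sum_congr rfl fun A _ => ?_
  rw [coeff_conj, coeff_conj]
  obtain ⟨B, rfl⟩ : ∃ B, D = A ∆ B := ⟨A ∆ D, by simp⟩
  rw [symmDiff_symmDiff_cancel_left]
  simp only [mulSign_symmDiff_left, mulSign_symmDiff_right]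
  linear_combination (mulSign A A * mulSign B A * mulSign B B * coeff a A * coeff b B) *
    mulSign_mul_self A B

theorem involute_mul (a b : Cl n) : involute (a * b) = involute a * involute b := by
  refine coeff_ext fun D => ?_
  simp only [← mul_eq]
  rw [coeff_involute, coeff_mul, coeff_mul, Finset.mul_sum]
  refine Finset.sum_congr rfl fun A _ => ?_
  rw [coeff_involute, coeff_involute]
  obtain ⟨B, rfl⟩ : ∃ B, D = A ∆ B := ⟨A ∆ D, by simp⟩
  rw [symmDiff_symmDiff_cancel_left, neg_one_pow_card_symmDiff]
  ring

theorem reverse_eq (a : Cl n) : reverse a = involute (conj a) :=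
  coeff_ext fun A => by rw [coeff_reverse, coeff_involute, coeff_conj]

theorem reverse_mul (a b : Cl n) : reverse (a * b) = reverse b * reverse a := by
  simp only [reverse_eq, conj_mul, involute_mul]

@[simp] theorem conj_zero : conj (0 : Cl n) = 0 := coeff_ext fun A => by simp [coeff_conj]

theorem conj_add (a b : Cl n) : conj (a + b) = conj a + conj b :=
  coeff_ext fun A => by simp only [coeff_conj, coeff_add, mul_add]

theorem reverse_add (a b : Cl n) : reverse (a + b) = reverse a + reverse b :=
  coeff_ext fun A => by simp only [coeff_reverse, coeff_add, mul_add]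

theorem conj_smul (r : ℝ) (a : Cl n) : conj (r • a) = r • conj a :=
  coeff_ext fun A => by simp only [coeff_conj, coeff_smul]; ring

theorem conj_one : conj (1 : Cl n) = 1 :=
  coeff_ext fun A => by
    rw [coeff_conj, ← one_eq, coeff_one]
    split_ifs with h <;> simp [h]

theorem conj_e (i : Fin n) : conj (e i) = -e i :=
  coeff_ext fun A => by
    rw [coeff_conj, coeff_neg, coeff_e]
    split_ifs with h
    · simp [h, mulSign_self]
    · simp

theorem conj_sum {ι : Type*} (s : Finset ι) (a : ι → Cl n) :
    conj (∑ i ∈ s, a i) = ∑ i ∈ s, conj (a i) :=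
  coeff_ext fun A => by simp only [coeff_conj, coeff_sum, Finset.mul_sum]

/-! ### The norm -/

theorem norm_sq (a : Cl n) : norm a ^ 2 = ∑ A, coeff a A ^ 2 :=
  Real.sq_sqrt (Finset.sum_nonneg fun _ _ => sq_nonneg _)

theorem norm_nonneg' (a : Cl n) : 0 ≤ norm a := Real.sqrt_nonneg _

theorem eq_zero_of_norm_eq_zero {a : Cl n} (h : norm a = 0) : a = 0 := by
  have hs := norm_sq a
  rw [h, zero_pow two_ne_zero, eq_comm,
    Finset.sum_eq_zero_iff_of_nonneg fun _ _ => sq_nonneg _] at hs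
  exact coeff_ext fun A => pow_eq_zero_iff two_ne_zero |>.1 (hs A (Finset.mem_univ A))

theorem coeff_mul_conj_empty (a : Cl n) : coeff (a * conj a) ∅ = norm a ^ 2 := by
  rw [norm_sq, ← mul_eq, coeff_mul]
  refine Finset.sum_congr rfl fun A _ => ?_
  rw [← Finset.bot_eq_empty, symmDiff_bot, coeff_conj]
  linear_combination coeff a A ^ 2 * mulSign_mul_self A A

theorem coeff_conj_mul_empty (a : Cl n) : coeff (conj a * a) ∅ = norm a ^ 2 := by
  rw [norm_sq, ← mul_eq, coeff_mul]
  refine Finset.sum_congr rfl fun A _ => ?_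
  rw [← Finset.bot_eq_empty, symmDiff_bot, coeff_conj]
  linear_combination coeff a A ^ 2 * mulSign_mul_self A A

theorem coeff_smul_one_empty (r : ℝ) : coeff (r • (1 : Cl n)) ∅ = r := by
  simp [← one_eq, coeff_one]

/-- `a` has scalar norm forms `a * conj a` and `conj a * a`. -/
def IsSimilitude (a : Cl n) : Prop :=
  a * conj a = norm a ^ 2 • (1 : Cl n) ∧ conj a * a = norm a ^ 2 • (1 : Cl n)

theorem IsSimilitude.of_exists {a : Cl n} (h₁ : ∃ r : ℝ, a * conj a = r • (1 : Cl n))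
    (h₂ : ∃ r : ℝ, conj a * a = r • (1 : Cl n)) : IsSimilitude a := by
  obtain ⟨r, hr⟩ := h₁
  obtain ⟨s, hs⟩ := h₂
  have h1 := coeff_mul_conj_empty a
  have h2 := coeff_conj_mul_empty a
  rw [hr, coeff_smul_one_empty] at h1
  rw [hs, coeff_smul_one_empty] at h2
  exact ⟨h1 ▸ hr, h2 ▸ hs⟩

theorem IsSimilitude.zero : IsSimilitude (0 : Cl n) :=
  .of_exists ⟨0, by simp⟩ ⟨0, by simp⟩

theorem IsSimilitude.one : IsSimilitude (1 : Cl n) :=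
  .of_exists ⟨1, by simp [conj_one]⟩ ⟨1, by simp [conj_one]⟩

theorem IsSimilitude.mul {a b : Cl n} (ha : IsSimilitude a) (hb : IsSimilitude b) :
    IsSimilitude (a * b) := by
  refine .of_exists ⟨norm b ^ 2 * norm a ^ 2, ?_⟩ ⟨norm a ^ 2 * norm b ^ 2, ?_⟩
  · rw [conj_mul, mul_assoc, ← mul_assoc b, hb.1, smul_mul_assoc, one_mul, mul_smul_comm, ha.1,
      smul_smul]
  · rw [conj_mul, mul_assoc, ← mul_assoc (conj a), ha.2, smul_mul_assoc, one_mul, mul_smul_comm,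
      hb.2, smul_smul]

theorem IsSimilitude.mul_inv {a : Cl n} (ha : IsSimilitude a) (h : norm a ≠ 0) :
    a * inv a = 1 ∧ inv a = (norm a ^ 2)⁻¹ • conj a := by
  have h1 : a * ((norm a ^ 2)⁻¹ • conj a) = 1 := by
    rw [mul_smul_comm, ha.1, smul_smul, inv_mul_cancel₀ (pow_ne_zero 2 h), one_smul]
  have h2 : ((norm a ^ 2)⁻¹ • conj a) * a = 1 := by
    rw [smul_mul_assoc, ha.2, smul_smul, inv_mul_cancel₀ (pow_ne_zero 2 h), one_smul]
  have hinv : IsInvertible a := ⟨_, h1, h2⟩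
  have h3 : a * inv a = 1 := by
    rw [inv, dif_pos hinv]
    exact hinv.choose_spec.1
  exact ⟨h3, (left_inv_eq_right_inv h2 h3).symm⟩

/-! ### Paravectors -/

theorem e_mul_self (i : Fin n) : e i * e i = -1 := by
  refine coeff_ext fun C => ?_
  rw [← mul_eq, coeff_e_mul, coeff_neg, ← one_eq, coeff_one, coeff_e]
  by_cases h : C = ∅
  · simp [h, mulSign_self, ← Finset.bot_eq_empty]
  · have : ({i} : Finset (Fin n)) ∆ C ≠ {i} := by
      rwa [Ne, symmDiff_eq_left, Finset.bot_eq_empty]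
    simp [h, this]

theorem e_mul_e_of_ne {i j : Fin n} (h : i ≠ j) : e i * e j = -(e j * e i) := by
  refine coeff_ext fun C => ?_
  rw [coeff_neg, ← mul_eq, ← mul_eq, coeff_e_mul, coeff_mul_e, coeff_e]
  split_ifs with hC
  · rw [hC]
    simp only [mulSign_eq_prod, Finset.prod_singleton, pairSign]
    rcases lt_or_gt_of_ne h with h | h <;> simp [h.le, h.not_ge]
  · simp

theorem sum_e_mul_e_mul (H : Fin n → Fin n → Cl n) (hH : ∀ i j, H i j = H j i) :
    ∑ i, ∑ j, e i * (e j * H i j) = -∑ i, H i i := by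
  have h1 : ∀ i j, e i * (e j * H i j) + e j * (e i * H j i) =
      if i = j then (-2 : ℝ) • H i i else 0 := by
    intro i j
    split_ifs with h
    · subst h
      rw [← mul_assoc, e_mul_self, neg_one_mul]
      module
    · rw [hH j i, ← mul_assoc, ← mul_assoc, e_mul_e_of_ne h, neg_mul, neg_add_cancel]
  have h2 : (2 : ℝ) • ∑ i, ∑ j, e i * (e j * H i j) = (2 : ℝ) • (-∑ i, H i i) := by
    rw [two_smul]
    conv_lhs => arg 2; rw [Finset.sum_comm]
    simp only [← Finset.sum_add_distrib, h1, Finset.sum_ite_eq, Finset.mem_univ, if_true,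
      ← Finset.smul_sum]
    module
  exact smul_right_injective _ (two_ne_zero' ℝ) h2

theorem isSimilitude_para (x : Fin (n + 1) → ℝ) : IsSimilitude (para x) := by
  obtain ⟨v, hv⟩ : ∃ v : Cl n, v = ∑ i : Fin n, x i.succ • e i := ⟨_, rfl⟩
  have hpara : para x = x 0 • (1 : Cl n) + v := by
    rw [para, scalar_eq_smul_one, hv, one_eq]
  have hconj : conj (para x) = x 0 • (1 : Cl n) - v := by
    rw [hpara, conj_add, conj_smul, conj_one, hv, conj_sum, sub_eq_add_neg,
      ← Finset.sum_neg_distrib]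
    simp only [conj_smul, conj_e, smul_neg]
  have hvv : v * v = (-∑ i : Fin n, x i.succ * x i.succ) • (1 : Cl n) := by
    rw [neg_smul, Finset.sum_smul,
      ← sum_e_mul_e_mul (fun i j => (x i.succ * x j.succ) • (1 : Cl n))
        fun i j => by rw [mul_comm (x i.succ)]]
    simp only [hv, Finset.sum_mul_sum, mul_smul_comm, smul_mul_assoc, mul_one, smul_smul]
    simp only [mul_comm]
  refine .of_exists ⟨x 0 ^ 2 + ∑ i : Fin n, x i.succ * x i.succ, ?_⟩
    ⟨x 0 ^ 2 + ∑ i : Fin n, x i.succ * x i.succ, ?_⟩ <;>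
  · rw [hconj, hpara]
    simp only [mul_add, add_mul, mul_sub, sub_mul, hvv, smul_mul_assoc, mul_smul_comm, mul_one,
      one_mul]
    module

theorem IsProdOfParavectors.isSimilitude {a : Cl n} (h : IsProdOfParavectors a) :
    IsSimilitude a := by
  obtain ⟨l, -, rfl⟩ := h
  induction l with
  | nil => exact .one
  | cons x l ih => exact (isSimilitude_para x).mul ih

theorem isSimilitude_of_eq_zero_or {a : Cl n} (h : a = 0 ∨ IsProdOfParavectors a) :
    IsSimilitude a := by
  rcases h with rfl | h
  exacts [.zero, h.isSimilitude]

theorem para_add (x y : Fin (n + 1) → ℝ) : para (x + y) = para x + para y := by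
  simp only [para, scalar_eq_smul_one, Pi.add_apply, add_smul, Finset.sum_add_distrib]
  abel

theorem isSimilitude_cxd (M : SAV n) (x : Fin (n + 1) → ℝ) : IsSimilitude (cxd M x) := by
  by_cases hc : M.c = 0
  · rw [cxd, hc, mul_eq, zero_mul, zero_add]
    exact isSimilitude_of_eq_zero_or M.prod_d
  · obtain ⟨y, hy⟩ := (M.cond_c hc).2
    have hsim := isSimilitude_of_eq_zero_or M.prod_c
    have hd : M.c * para y = M.d := by
      rw [← hy, mul_eq, ← mul_assoc,
        (hsim.mul_inv fun h => hc (eq_zero_of_norm_eq_zero h)).1, one_mul]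
    rw [cxd, mul_eq, ← hd, ← mul_add, ← para_add]
    exact hsim.mul (isSimilitude_para _)

/-! ### The subalgebra without the last generator -/

theorem memSub.add {a b : Cl n} {i} (ha : memSub a i) (hb : memSub b i) : memSub (a + b) i :=
  fun A hA => by rw [coeff_add, ha A hA, hb A hA, add_zero]

theorem memSub.mul {a b : Cl n} {i} (ha : memSub a i) (hb : memSub b i) : memSub (a * b) i := by
  intro C hC
  rw [← mul_eq, coeff_mul]
  refine Finset.sum_eq_zero fun A _ => ?_
  by_cases hA : i ∈ A
  · simp [ha A hA]
  · have : i ∈ A ∆ C := Finset.mem_symmDiff.2 (Or.inr ⟨hC, hA⟩)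
    simp [hb _ this]

theorem memSub.conj {a : Cl n} {i} (ha : memSub a i) : memSub (conj a) i :=
  fun A hA => by rw [coeff_conj, ha A hA, mul_zero]

theorem memSub.e_last_mul {m : ℕ} {a : Cl (m + 1)} (ha : memSub a (Fin.last m)) :
    e (Fin.last m) * a = involute a * e (Fin.last m) := by
  refine coeff_ext fun C => ?_
  rw [← mul_eq, ← mul_eq, coeff_e_mul, coeff_mul_e, coeff_involute]
  obtain ⟨D, hD⟩ : ∃ D, D = {Fin.last m} ∆ C := ⟨_, rfl⟩
  rw [← hD]
  by_cases hl : Fin.last m ∈ D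
  · simp [ha D hl]
  · have h1 : mulSign {Fin.last m} D = (-1) ^ D.card := by
      rw [mulSign_eq_prod, Finset.prod_singleton, ← Finset.prod_const]
      exact Finset.prod_congr rfl fun j _ => if_pos (Fin.le_last j)
    have h2 : mulSign D {Fin.last m} = 1 := by
      rw [mulSign_eq_prod]
      refine Finset.prod_eq_one fun i hi => ?_
      rw [Finset.prod_singleton, pairSign, if_neg]
      exact fun h => hl (Fin.last_le_iff.1 h ▸ hi)
    rw [h1, h2, one_mul]

theorem exists_para_eq {m : ℕ} (x : Fin (m + 2) → ℝ) : ∃ y : Cl (m + 1),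
    memSub y (Fin.last m) ∧ reverse y = y ∧
      para x = y + x (Fin.last (m + 1)) • e (Fin.last m) := by
  refine ⟨x 0 • (1 : Cl (m + 1)) + ∑ i : Fin m, x i.castSucc.succ • e i.castSucc, ?_, ?_, ?_⟩
  · intro A hA
    have h0 : A ≠ ∅ := Finset.ne_empty_of_mem hA
    have hi : ∀ i : Fin m, A ≠ {i.castSucc} := by
      rintro i rfl
      exact (Fin.castSucc_ne_last i) (Finset.mem_singleton.1 hA).symm
    simp [coeff_sum, ← one_eq, coeff_one, coeff_e, h0, hi]
  · refine coeff_ext fun A => ?_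
    simp only [coeff_reverse, coeff_sum, coeff_add, coeff_smul, ← one_eq, coeff_one, coeff_e,
      mul_add, Finset.mul_sum]
    congr 1
    · by_cases h : A = ∅ <;> simp [h]
    · refine Finset.sum_congr rfl fun i _ => ?_
      by_cases h : A = {i.castSucc} <;> simp [h, mulSign_self]
  · rw [para, scalar_eq_smul_one, Fin.sum_univ_castSucc, one_eq, ← add_assoc]
    rfl

/-- The last coordinate of `M<x>`. -/
theorem moebius_last {m : ℕ} (M : SAVsub m) (x : Fin (m + 2) → ℝ)
    (h : norm (cxd M.toSAV x) ≠ 0) :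
    moebius M.toSAV x (Fin.last (m + 1)) =
      x (Fin.last (m + 1)) / norm (cxd M.toSAV x) ^ 2 := by
  obtain ⟨y, hy, hrev, hx⟩ := exists_para_eq x
  set t := x (Fin.last (m + 1))
  set ε : Cl (m + 1) := e (Fin.last m)
  have hinv := ((isSimilitude_cxd M.toSAV x).mul_inv h).2
  have hdet : M.a * reverse M.d - M.b * reverse M.c = 1 := M.det
  have hA : memSub (M.a * y + M.b) (Fin.last m) := (M.sub_a.mul hy).add M.sub_b
  have hC : memSub (M.c * y + M.d) (Fin.last m) := (M.sub_c.mul hy).add M.sub_d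
  have hswap : ∀ a : Cl (m + 1), memSub a (Fin.last m) → ε * conj a = reverse a * ε := by
    intro a ha
    rw [ha.conj.e_last_mul, reverse_eq]
  have hεc : ε * conj M.c * ε = -reverse M.c := by
    rw [hswap _ M.sub_c, mul_assoc, e_mul_self, mul_neg_one]
  have hcεε : M.a * ε * (ε * conj M.c) = -(M.a * conj M.c) := by
    rw [mul_assoc, ← mul_assoc ε ε, e_mul_self, neg_one_mul, mul_neg]
  have hnum : axb M.toSAV x = (M.a * y + M.b) + t • (M.a * ε) := by
    rw [axb, hx, mul_eq, mul_add, mul_smul_comm]; abel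
  have hden : conj (cxd M.toSAV x) = conj (M.c * y + M.d) - t • (ε * conj M.c) := by
    rw [cxd, hx, mul_eq, mul_add, mul_smul_comm, add_right_comm, conj_add, conj_smul, conj_mul _ ε,
      conj_e, neg_mul, smul_neg, sub_eq_add_neg]
  have hprod : axb M.toSAV x * conj (cxd M.toSAV x) =
      ((M.a * y + M.b) * conj (M.c * y + M.d) + (t ^ 2) • (M.a * conj M.c)) + t • ε := by
    have h1 : M.a * ε * conj (M.c * y + M.d) - (M.a * y + M.b) * (ε * conj M.c) = ε := by
      rw [mul_assoc M.a, hswap _ hC, hswap _ M.sub_c, reverse_add, reverse_mul, hrev]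
      calc _ = (M.a * reverse M.d - M.b * reverse M.c) * ε := by noncomm_ring
        _ = ε := by rw [hdet, one_mul]
    calc _ = (M.a * y + M.b) * conj (M.c * y + M.d) -
          (t ^ 2) • (M.a * ε * (ε * conj M.c)) +
          t • (M.a * ε * conj (M.c * y + M.d) - (M.a * y + M.b) * (ε * conj M.c)) := by
          rw [hnum, hden]
          simp only [mul_sub (_ + _ : Cl (m + 1)), add_mul _ (t • _), mul_smul_comm,
            smul_mul_assoc, smul_smul]
          module
      _ = _ := by
          rw [h1, hcεε, smul_neg, sub_neg_eq_add]
  have hε : coeff ε {Fin.last m} = 1 := by simp [ε, coeff_e]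
  have hlast : Fin.last (m + 1) = (Fin.last m).succ := rfl
  rw [moebius, hlast, paraCoord, Fin.cases_succ, moebiusCl, mul_eq, hinv, mul_smul_comm, hprod,
    coeff_smul, coeff_add, coeff_add, coeff_smul, coeff_smul, hε,
    hA.mul hC.conj _ (Finset.mem_singleton_self _),
    M.sub_a.mul M.sub_c.conj _ (Finset.mem_singleton_self _)]
  ring

end

end Cl

namespace Cl

variable {n : ℕ}

/-! ### Partial derivatives -/

theorem pderiv_congr {E : Type*} [NormedAddCommGroup E] [NormedSpace ℝ E] {k : ℕ}
    {s : Set (Fin k → ℝ)} (hs : IsOpen s) {f g : (Fin k → ℝ) → E} (h : Set.EqOn f g s)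
    (i : Fin k) {x : Fin k → ℝ} (hx : x ∈ s) : pderiv i f x = pderiv i g x := by
  rw [pderiv, pderiv, (h.eventuallyEq_of_mem (hs.mem_nhds hx)).fderiv_eq]

theorem differentiableAt_pderiv {E : Type*} [NormedAddCommGroup E] [NormedSpace ℝ E] {k : ℕ}
    {f : (Fin k → ℝ) → E} {x : Fin k → ℝ} (hf : ContDiffAt ℝ 2 f x) (i : Fin k) :
    DifferentiableAt ℝ (pderiv i f) x := by
  have h : DifferentiableAt ℝ (fderiv ℝ f) x :=
    (hf.fderiv_right (m := 1) (by norm_num)).differentiableAt one_ne_zero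
  exact h.clm_apply (differentiableAt_const _)

theorem pderiv_pderiv_eq {E : Type*} [NormedAddCommGroup E] [NormedSpace ℝ E] {k : ℕ}
    {f : (Fin k → ℝ) → E} {x : Fin k → ℝ} (hf : ContDiffAt ℝ 2 f x) (i j : Fin k) :
    pderiv i (pderiv j f) x = fderiv ℝ (fderiv ℝ f) x (Pi.single i 1) (Pi.single j 1) := by
  have h : DifferentiableAt ℝ (fderiv ℝ f) x :=
    (hf.fderiv_right (m := 1) (by norm_num)).differentiableAt one_ne_zero
  have h2 := h.hasFDerivAt.clm_apply (hasFDerivAt_const (Pi.single j (1 : ℝ)) x)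
  have h3 : pderiv i (pderiv j f) x = _ := congrArg (fun L => L (Pi.single i 1)) h2.fderiv
  rw [h3]
  simp

theorem pderiv_comm {E : Type*} [NormedAddCommGroup E] [NormedSpace ℝ E] {k : ℕ}
    {f : (Fin k → ℝ) → E} {x : Fin k → ℝ} (hf : ContDiffAt ℝ 2 f x) (i j : Fin k) :
    pderiv i (pderiv j f) x = pderiv j (pderiv i f) x := by
  rw [pderiv_pderiv_eq hf, pderiv_pderiv_eq hf]
  exact hf.isSymmSndFDerivAt (by simp) _ _

theorem pderiv_add {E : Type*} [NormedAddCommGroup E] [NormedSpace ℝ E] {k : ℕ}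
    {f g : (Fin k → ℝ) → E} {x : Fin k → ℝ} (hf : DifferentiableAt ℝ f x)
    (hg : DifferentiableAt ℝ g x) (i : Fin k) :
    pderiv i (fun y => f y + g y) x = pderiv i f x + pderiv i g x :=
  congrArg (fun T => T (Pi.single i 1)) (hf.hasFDerivAt.add hg.hasFDerivAt).fderiv

theorem pderiv_const_mul {k : ℕ} {f : (Fin k → ℝ) → ℝ} {x : Fin k → ℝ}
    (hf : DifferentiableAt ℝ f x) (r : ℝ) (i : Fin k) :
    pderiv i (fun y => r * f y) x = r * pderiv i f x :=
  congrArg (fun T => T (Pi.single i 1)) (hf.hasFDerivAt.const_mul r).fderiv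

theorem pderiv_clm_comp {E F : Type*} [NormedAddCommGroup E] [NormedSpace ℝ E]
    [NormedAddCommGroup F] [NormedSpace ℝ F] {k : ℕ} (L : E →L[ℝ] F)
    {f : (Fin k → ℝ) → E} {x : Fin k → ℝ} (hf : DifferentiableAt ℝ f x) (i : Fin k) :
    pderiv i (fun y => L (f y)) x = L (pderiv i f x) :=
  congrArg (fun T => T (Pi.single i 1)) (L.hasFDerivAt.comp x hf.hasFDerivAt).fderiv

/-! ### Monogenic functions are harmonic -/

instance : FiniteDimensional ℝ (Cl n) :=
  inferInstanceAs (FiniteDimensional ℝ (Finset (Fin n) → ℝ))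

section

attribute [local instance] cliffordRing cliffordAlgebra

/-- Left multiplication by `a` as a continuous linear map. -/
def mulLeftCLM (a : Cl n) : Cl n →L[ℝ] Cl n :=
  LinearMap.toContinuousLinearMap
    { toFun := fun b => mul a b
      map_add' := fun b c => mul_add (a : Cl n) b c
      map_smul' := fun r b => mul_smul_comm r a b }

@[simp] theorem mulLeftCLM_apply (a b : Cl n) : mulLeftCLM a b = mul a b := rfl

theorem pderiv_dirac {f : (Fin (n + 1) → ℝ) → Cl n} {x : Fin (n + 1) → ℝ}
    (hf : ContDiffAt ℝ 2 f x) (j : Fin (n + 1)) :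
    pderiv j (dirac f) x =
      pderiv j (pderiv 0 f) x + ∑ i : Fin n, mul (e i) (pderiv j (pderiv i.succ f) x) := by
  have h := (differentiableAt_pderiv hf 0).hasFDerivAt.add
    (HasFDerivAt.fun_sum (u := Finset.univ) fun (i : Fin n) _ =>
      (mulLeftCLM (e i)).hasFDerivAt.comp x (differentiableAt_pderiv hf i.succ).hasFDerivAt)
  have h2 : pderiv j (dirac f) x = _ := congrArg (fun T => T (Pi.single j 1)) h.fderiv
  rw [h2]
  simp [pderiv]

theorem lap_eq_zero_of_dirac_eq_zero {s : Set (Fin (n + 1) → ℝ)} (hs : IsOpen s)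
    {f : (Fin (n + 1) → ℝ) → Cl n} (hf : ContDiffOn ℝ 2 f s) (hD : ∀ x ∈ s, dirac f x = 0)
    {x : Fin (n + 1) → ℝ} (hx : x ∈ s) : lap f x = 0 := by
  have hfx : ContDiffAt ℝ 2 f x := hf.contDiffAt (hs.mem_nhds hx)
  have h0 : ∀ j, pderiv j (pderiv 0 f) x +
      ∑ i : Fin n, e i * pderiv j (pderiv i.succ f) x = 0 := by
    intro j
    have h : pderiv j (dirac f) x = 0 := by
      rw [pderiv_congr hs (g := fun _ => (0 : Cl n)) hD j hx, pderiv, fderiv_fun_const]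
      rfl
    rw [pderiv_dirac hfx] at h
    exact h
  have hsum : ∑ j : Fin n, e j * (pderiv j.succ (pderiv 0 f) x +
      ∑ i : Fin n, e i * pderiv j.succ (pderiv i.succ f) x) = 0 :=
    Finset.sum_eq_zero fun j _ => by rw [h0, mul_zero]
  simp only [mul_add, Finset.mul_sum, Finset.sum_add_distrib] at hsum
  rw [sum_e_mul_e_mul _ fun i j => pderiv_comm hfx _ _] at hsum
  have h00 := h0 0
  simp only [fun i : Fin n => pderiv_comm hfx 0 i.succ] at h00
  rw [lap, Fin.sum_univ_succ, ← sub_eq_zero.2 (h00.trans hsum.symm)]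
  abel

end

/-- The coefficient functional at `e_A` as a continuous linear map. -/
def coeffCLM (A : Finset (Fin n)) : Cl n →L[ℝ] ℝ :=
  LinearMap.toContinuousLinearMap
    { toFun := fun b => coeff b A
      map_add' := fun _ _ => rfl
      map_smul' := fun _ _ => rfl }

theorem lap_coeff {s : Set (Fin (n + 1) → ℝ)} (hs : IsOpen s)
    {f : (Fin (n + 1) → ℝ) → Cl n} (hf : ContDiffOn ℝ 2 f s) (A : Finset (Fin n))
    {x : Fin (n + 1) → ℝ} (hx : x ∈ s) : lap (fun y => coeff (f y) A) x = coeff (lap f x) A := by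
  have hat : ∀ y ∈ s, ContDiffAt ℝ 2 f y := fun y hy => hf.contDiffAt (hs.mem_nhds hy)
  have h1 : ∀ i, pderiv i (pderiv i fun y => coeff (f y) A) x =
      coeff (pderiv i (pderiv i f) x) A := by
    intro i
    have hfst : Set.EqOn (pderiv i fun y => coeff (f y) A) (fun y => coeffCLM A (pderiv i f y)) s :=
      fun y hy => pderiv_clm_comp (coeffCLM A) ((hat y hy).differentiableAt two_ne_zero) i
    rw [pderiv_congr hs hfst i hx]
    exact pderiv_clm_comp (coeffCLM A) (differentiableAt_pderiv (hat x hx) i) i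
  rw [lap, lap, coeff_sum]
  exact Finset.sum_congr rfl fun i _ => h1 i

/-! ### Powers of the last coordinate -/

theorem isOpen_upperHalf (n : ℕ) : IsOpen (upperHalf n) :=
  isOpen_lt continuous_const (continuous_apply _)

theorem hasFDerivAt_last_rpow {x : Fin (n + 1) → ℝ} (hx : x ∈ upperHalf n) (s : ℝ) :
    HasFDerivAt (fun y : Fin (n + 1) → ℝ => y (Fin.last n) ^ s)
      ((s * x (Fin.last n) ^ (s - 1)) •
        ContinuousLinearMap.proj (R := ℝ) (φ := fun _ => ℝ) (Fin.last n)) x :=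
  (hasFDerivAt_apply (𝕜 := ℝ) (Fin.last n) x).rpow_const (Or.inl (ne_of_gt hx))

theorem pderiv_last_rpow_mul {x : Fin (n + 1) → ℝ} (hx : x ∈ upperHalf n) (s : ℝ)
    {φ : (Fin (n + 1) → ℝ) → ℝ} (hφ : DifferentiableAt ℝ φ x) (i : Fin (n + 1)) :
    pderiv i (fun y => y (Fin.last n) ^ s * φ y) x =
      (if i = Fin.last n then s * (x (Fin.last n) ^ (s - 1) * φ x) else 0) +
        x (Fin.last n) ^ s * pderiv i φ x := by
  have h : pderiv i (fun y => y (Fin.last n) ^ s * φ y) x = _ :=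
    congrArg (fun T => T (Pi.single i 1))
      ((hasFDerivAt_last_rpow hx s).mul hφ.hasFDerivAt).fderiv
  rw [h]
  by_cases hi : i = Fin.last n
  · subst hi
    simp [pderiv]
    ring
  · simp [pderiv, hi, Ne.symm hi]

theorem differentiableAt_last_rpow_mul {x : Fin (n + 1) → ℝ} (hx : x ∈ upperHalf n) (s : ℝ)
    {φ : (Fin (n + 1) → ℝ) → ℝ} (hφ : DifferentiableAt ℝ φ x) :
    DifferentiableAt ℝ (fun y => y (Fin.last n) ^ s * φ y) x :=
  (hasFDerivAt_last_rpow hx s).differentiableAt.mul hφ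

theorem pderiv_pderiv_last_rpow_mul {x : Fin (n + 1) → ℝ} (hx : x ∈ upperHalf n) (s : ℝ)
    {φ : (Fin (n + 1) → ℝ) → ℝ} (hφ : ContDiffOn ℝ 2 φ (upperHalf n)) (i : Fin (n + 1)) :
    pderiv i (pderiv i fun y => y (Fin.last n) ^ s * φ y) x =
      (if i = Fin.last n then s * (s - 1) * x (Fin.last n) ^ (s - 2) * φ x +
        2 * s * x (Fin.last n) ^ (s - 1) * pderiv (Fin.last n) φ x else 0) +
        x (Fin.last n) ^ s * pderiv i (pderiv i φ) x := by
  have hat : ∀ y ∈ upperHalf n, ContDiffAt ℝ 2 φ y :=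
    fun y hy => hφ.contDiffAt ((isOpen_upperHalf n).mem_nhds hy)
  have hd : ∀ y ∈ upperHalf n, DifferentiableAt ℝ φ y :=
    fun y hy => (hat y hy).differentiableAt two_ne_zero
  have hd2 := differentiableAt_pderiv (hat x hx) i
  rw [pderiv_congr (isOpen_upperHalf n)
    (fun y hy => pderiv_last_rpow_mul hy s (hd y hy) i) i hx]
  by_cases hi : i = Fin.last n
  · subst hi
    have hd1 := differentiableAt_last_rpow_mul hx (s - 1) (hd x hx)
    simp only [if_true]
    rw [pderiv_add (hd1.const_mul s) (differentiableAt_last_rpow_mul hx s hd2),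
      pderiv_const_mul hd1, pderiv_last_rpow_mul hx _ (hd x hx), pderiv_last_rpow_mul hx _ hd2,
      if_pos rfl, if_pos rfl, sub_sub, one_add_one_eq_two]
    ring
  · simp only [if_neg hi, zero_add]
    rw [pderiv_last_rpow_mul hx s hd2, if_neg hi, zero_add]

theorem lap_last_rpow_mul {x : Fin (n + 1) → ℝ} (hx : x ∈ upperHalf n) (s : ℝ)
    {φ : (Fin (n + 1) → ℝ) → ℝ} (hφ : ContDiffOn ℝ 2 φ (upperHalf n)) :
    lap (fun y => y (Fin.last n) ^ s * φ y) x =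
      s * (s - 1) * x (Fin.last n) ^ (s - 2) * φ x +
        2 * s * x (Fin.last n) ^ (s - 1) * pderiv (Fin.last n) φ x +
        x (Fin.last n) ^ s * lap φ x := by
  simp only [lap, pderiv_pderiv_last_rpow_mul hx s hφ, Finset.sum_add_distrib,
    Finset.sum_ite_eq', Finset.mem_univ, if_true, Finset.mul_sum]

/-- If `φ` is harmonic on the upper half-space, then `xₙ^s φ` is an eigenfunction of
`xₙ²Δ - 2s xₙ ∂/∂xₙ` with eigenvalue `-s(s+1)`. -/
theorem sq_mul_lap_last_rpow_mul {x : Fin (n + 1) → ℝ} (hx : x ∈ upperHalf n) (s : ℝ)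
    {φ : (Fin (n + 1) → ℝ) → ℝ} (hφ : ContDiffOn ℝ 2 φ (upperHalf n)) (hlap : lap φ x = 0) :
    x (Fin.last n) ^ 2 * lap (fun y => y (Fin.last n) ^ s * φ y) x -
        2 * s * x (Fin.last n) *
          pderiv (Fin.last n) (fun y => y (Fin.last n) ^ s * φ y) x =
      -(s * (s + 1)) * (x (Fin.last n) ^ s * φ x) := by
  have hx0 : 0 < x (Fin.last n) := hx
  have hd := (hφ.contDiffAt ((isOpen_upperHalf n).mem_nhds hx)).differentiableAt two_ne_zero
  rw [lap_last_rpow_mul hx s hφ, pderiv_last_rpow_mul hx s hd, if_pos rfl, hlap,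
    Real.rpow_sub hx0, Real.rpow_sub_one hx0.ne', Real.rpow_two]
  field_simp
  ring

end Cl

/-- Theorem 4 (relation to Maaß wave forms): if `f` is a left monogenic automorphic form of
weight `n` (`n = m + 2 ≥ 2`), then `g = xₙ^{(n-1)/2} f` transforms with the weight `-1`
factor `conj(cx+d)/‖cx+d‖²` and each real component `u` of `g` solves the Maaß wave
equation `Δu - ((n-1)/xₙ) ∂u/∂xₙ + ((n²-1)/4) u/xₙ² = 0`, i.e. is an eigenfunction of the
Laplace–Beltrami operator `xₙ²Δ - (n-1)xₙ ∂/∂xₙ` with eigenvalue `-(n²-1)/4`. -/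
theorem monogenic_automorphic_form_gives_maass_form
    (m : ℕ) (M : Cl.SAVsub (m + 1))
    (f : (Fin (m + 3) → ℝ) → Cl (m + 2))
    (hf : ContDiffOn ℝ (⊤ : ℕ∞) f (Cl.upperHalf (m + 2)))
    (hmono : ∀ x ∈ Cl.upperHalf (m + 2), Cl.dirac f x = 0)
    (htrans : ∀ x ∈ Cl.upperHalf (m + 2),
      f x = (Cl.norm (Cl.cxd M.toSAV x) ^ (((m : ℤ) + 2) + 1))⁻¹ •
        Cl.mul (Cl.conj (Cl.cxd M.toSAV x)) (f (Cl.moebius M.toSAV x)))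
    (g : (Fin (m + 3) → ℝ) → Cl (m + 2))
    (hg : g = fun y => (y (Fin.last (m + 2)) ^ ((((m : ℝ) + 2) - 1) / 2)) • f y) :
    (∀ x ∈ Cl.upperHalf (m + 2),
      g x = (Cl.norm (Cl.cxd M.toSAV x) ^ 2)⁻¹ •
        Cl.mul (Cl.conj (Cl.cxd M.toSAV x)) (g (Cl.moebius M.toSAV x))) ∧
    ∀ A : Finset (Fin (m + 2)), ∀ u : (Fin (m + 3) → ℝ) → ℝ,
      u = (fun y => Cl.coeff (g y) A) →
      ∀ x ∈ Cl.upperHalf (m + 2),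
        (Cl.lap u x - (((m : ℝ) + 2) - 1) / x (Fin.last (m + 2)) *
            Cl.pderiv (Fin.last (m + 2)) u x +
          ((((m : ℝ) + 2) ^ 2 - 1) / 4) * u x / x (Fin.last (m + 2)) ^ 2 = 0) ∧
        (x (Fin.last (m + 2)) ^ 2 * Cl.lap u x -
            (((m : ℝ) + 2) - 1) * x (Fin.last (m + 2)) *
              Cl.pderiv (Fin.last (m + 2)) u x =
          -((((m : ℝ) + 2) ^ 2 - 1) / 4) * u x) := by
  have hs : ∀ x ∈ Cl.upperHalf (m + 2), 0 < x (Fin.last (m + 2)) := fun x hx => hx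
  subst hg
  refine ⟨fun x hx => ?_, ?_⟩
  · by_cases hN : Cl.norm (Cl.cxd M.toSAV x) = 0
    · have h0 := htrans x hx
      rw [hN, zero_zpow _ (by positivity), inv_zero, zero_smul] at h0
      simp only [hN, h0, smul_zero]
      simp
    · have hlast := Cl.moebius_last M x hN
      have hNpos : 0 < Cl.norm (Cl.cxd M.toSAV x) := lt_of_le_of_ne (Cl.norm_nonneg' _) (Ne.symm hN)
      have hx0 := hs x hx
      simp only
      rw [← Cl.mulLeftCLM_apply, map_smul, Cl.mulLeftCLM_apply, htrans x hx, hlast, smul_smul,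
        smul_smul]
      congr 1
      set N := Cl.norm (Cl.cxd M.toSAV x)
      have hpow : (N ^ 2) ^ ((((m : ℝ) + 2) - 1) / 2) = N ^ (m + 1) := by
        rw [← Real.rpow_natCast_mul hNpos.le, ← Real.rpow_natCast N (m + 1)]
        congr 1
        push_cast
        ring
      have hz : N ^ (((m : ℤ) + 2) + 1) = N ^ (m + 1) * N ^ 2 := by
        rw [← pow_add, ← zpow_natCast]
        congr 1
      rw [Real.div_rpow hx0.le (by positivity), hpow, hz]
      field_simp
  · intro A u hu x hx
    have hx0 := hs x hx
    have hf2 : ContDiffOn ℝ 2 f (Cl.upperHalf (m + 2)) := hf.of_le (WithTop.coe_le_coe.2 le_top)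
    have hφ : ContDiffOn ℝ 2 (fun y => Cl.coeff (f y) A) (Cl.upperHalf (m + 2)) :=
      (Cl.coeffCLM A).contDiff.comp_contDiffOn hf2
    have hlap : Cl.lap (fun y => Cl.coeff (f y) A) x = 0 := by
      rw [Cl.lap_coeff (Cl.isOpen_upperHalf _) hf2 A hx,
        Cl.lap_eq_zero_of_dirac_eq_zero (Cl.isOpen_upperHalf _) hf2 hmono hx, Cl.coeff_zero]
    have hu' : u = fun y => y (Fin.last (m + 2)) ^ ((((m : ℝ) + 2) - 1) / 2) * Cl.coeff (f y) A :=
      hu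
    have key := Cl.sq_mul_lap_last_rpow_mul hx ((((m : ℝ) + 2) - 1) / 2) hφ hlap
    rw [← hu', ← congrFun hu' x] at key
    refine ⟨?_, by linear_combination key⟩
    field_simp
    linear_combination 4 * key
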